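/- Let λ > 0 and let δ be a real number with 0 < δ < 1. Suppose v : {(x,y) ∈ ℝ² : x > 0} → ℂ is twice continuously differentiable and satisfies, at every point of the half-plane, −x²(∂²v/∂x² + ∂²v/∂y²) + 2·i·p(λx)·x·∂v/∂y + p(λx)²·v − 2·λ²·x²·conj(v) + λ²·x²·E(λx)·v = 0, where p(s) = 2s/sinh(2s) and E(s) = tanh(s)² + tanh(s)^(−2), and suppose |v(x,y)| ≤ x^δ for all x > 0 and all y ∈ ℝ. Then v is identically zero. -/

import Mathlib

/-- `E(s) = tanh(s)² + tanh(s)^(-2)`. -/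
noncomputable def modelE (s : ℝ) : ℝ := Real.tanh s ^ 2 + (Real.tanh s ^ 2)⁻¹

/-- `p(s) = 2s / sinh(2s)`. -/
noncomputable def modelP (s : ℝ) : ℝ := 2 * s / Real.sinh (2 * s)

open Filter Topology

/-- The second derivative test: the second derivative is nonpositive at a local maximum. -/
theorem second_deriv_nonpos_of_isLocalMax {f f' : ℝ → ℝ} {f'' t : ℝ}
    (hf : ∀ᶠ s in 𝓝 t, HasDerivAt f (f' s) s) (hf' : HasDerivAt f' f'' t)
    (hmax : IsLocalMax f t) : f'' ≤ 0 := by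
  by_contra! hpos
  have hderiv : deriv f =ᶠ[𝓝 t] f' := hf.mono fun s hs => hs.deriv
  have hderiv2 : deriv (deriv f) t = f'' := hderiv.deriv_eq.trans hf'.deriv
  have hmin : IsLocalMin f t := isLocalMin_of_deriv_deriv_pos (hderiv2.symm ▸ hpos)
    hmax.deriv_eq_zero hf.self_of_nhds.continuousAt
  have hconst : f =ᶠ[𝓝 t] fun _ => f t := by
    filter_upwards [hmin, hmax] with s h1 h2 using le_antisymm h2 h1
  have hzero : deriv f =ᶠ[𝓝 t] fun _ => 0 := by simpa using hconst.deriv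
  have : deriv (deriv f) t = 0 := by simpa using hzero.deriv_eq
  linarith

theorem hasDerivAt_sq_add_rpow {t s : ℝ} (γ : ℝ) (h : 0 < t ^ 2 + s) :
    HasDerivAt (fun t : ℝ => (t ^ 2 + s) ^ γ) (2 * γ * t * (t ^ 2 + s) ^ (γ - 1)) t := by
  have h1 : HasDerivAt (fun t : ℝ => t ^ 2 + s) (2 * t) t := by
    simpa using (hasDerivAt_pow 2 t).add_const s
  convert h1.rpow_const (p := γ) (Or.inl h.ne') using 1
  ring

theorem hasDerivAt_deriv_sq_add_rpow {t s : ℝ} (γ : ℝ) (h : 0 < t ^ 2 + s) :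
    HasDerivAt (fun t : ℝ => 2 * γ * t * (t ^ 2 + s) ^ (γ - 1))
      (2 * γ * (t ^ 2 + s) ^ (γ - 1) + 4 * γ * (γ - 1) * t ^ 2 * (t ^ 2 + s) ^ (γ - 2)) t := by
  have h1 : HasDerivAt (fun t : ℝ => 2 * γ * t) (2 * γ) t := by
    simpa using (hasDerivAt_id t).const_mul (2 * γ)
  refine (h1.mul (hasDerivAt_sq_add_rpow (γ - 1) h)).congr_deriv ?_
  rw [show γ - 1 - 1 = γ - 2 by ring]
  ring

/-- A barrier on the right half-plane, growing in all directions. -/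
noncomputable def halfPlaneBarrier (β x y : ℝ) : ℝ :=
  x ^ β + (1 - β) * (x ^ 2 + y ^ 2) ^ (β / 2)

theorem barrier_laplacian_neg {β x : ℝ} (y : ℝ) (hβ0 : 0 < β) (hβ1 : β < 1) (hx : 0 < x) :
    (β * (β - 1) * x ^ (β - 2) + (1 - β) * (2 * (β / 2) * (x ^ 2 + y ^ 2) ^ (β / 2 - 1)
        + 4 * (β / 2) * (β / 2 - 1) * x ^ 2 * (x ^ 2 + y ^ 2) ^ (β / 2 - 2)))
      + (1 - β) * (2 * (β / 2) * (y ^ 2 + x ^ 2) ^ (β / 2 - 1)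
        + 4 * (β / 2) * (β / 2 - 1) * y ^ 2 * (y ^ 2 + x ^ 2) ^ (β / 2 - 2)) < 0 := by
  rw [add_comm (y ^ 2)]
  have hq : 0 < x ^ 2 + y ^ 2 := by positivity
  have hmul : (x ^ 2 + y ^ 2) ^ (β / 2 - 1)
      = (x ^ 2 + y ^ 2) * (x ^ 2 + y ^ 2) ^ (β / 2 - 2) := by
    rw [show β / 2 - 1 = 1 + (β / 2 - 2) by ring, Real.rpow_add hq, Real.rpow_one]
  have hle : (x ^ 2 + y ^ 2) ^ (β / 2 - 1) ≤ x ^ (β - 2) := by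
    calc (x ^ 2 + y ^ 2) ^ (β / 2 - 1) ≤ (x ^ 2) ^ (β / 2 - 1) :=
          Real.rpow_le_rpow_of_nonpos (by positivity) (by nlinarith) (by linarith)
      _ = x ^ (β - 2) := by
          rw [← Real.rpow_natCast, ← Real.rpow_mul hx.le]; congr 1; push_cast; ring
  have hpos : 0 < x ^ (β - 2) := Real.rpow_pos_of_pos hx _
  have hlap : (1 - β) * β ^ 2 * (x ^ 2 + y ^ 2) ^ (β / 2 - 1)
      ≤ (1 - β) * β ^ 2 * x ^ (β - 2) :=
    mul_le_mul_of_nonneg_left hle (mul_nonneg (by linarith) (sq_nonneg β))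
  have hstrict : 0 < (1 - β) * (1 - β) * β * x ^ (β - 2) := by
    have : 0 < 1 - β := by linarith
    positivity
  have : (1 - β) * (4 * (β / 2) * (β / 2 - 1)) * (x ^ 2 + y ^ 2) ^ (β / 2 - 1)
      = (1 - β) * (4 * (β / 2) * (β / 2 - 1))
        * ((x ^ 2 + y ^ 2) * (x ^ 2 + y ^ 2) ^ (β / 2 - 2)) := by rw [hmul]
  nlinarith

/-- At an interior maximum of `‖v‖` minus a multiple of the barrier, the Laplacian of `v` twisted
by a rotation of arbitrary speed `k` in the second variable has negative component along `v`. -/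
theorem re_twisted_laplacian_neg_of_max {v : ℝ → ℝ → ℂ}
    (hreg : ContDiffOn ℝ 2 (fun p : ℝ × ℝ => v p.1 p.2) {p : ℝ × ℝ | 0 < p.1})
    {β ε x y : ℝ} (hβ0 : 0 < β) (hβ1 : β < 1) (hε : 0 < ε) (hx : 0 < x) (hv : v x y ≠ 0)
    (hmax : ∀ s t : ℝ, 0 < s →
      ‖v s t‖ - ε * halfPlaneBarrier β s t ≤ ‖v x y‖ - ε * halfPlaneBarrier β x y) (k : ℝ) :
    ((starRingEnd ℂ) (v x y) * (iteratedDeriv 2 (fun s => v s y) x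
      + iteratedDeriv 2 (fun t => v x t) y - 2 * Complex.I * k * deriv (fun t => v x t) y
      - k ^ 2 * v x y)).re < 0 := by
  have hn : 0 < ‖v x y‖ := norm_pos_iff.mpr hv
  have hopen : IsOpen {p : ℝ × ℝ | 0 < p.1} := isOpen_lt continuous_const continuous_fst
  have hCx : ∀ s, 0 < s → ContDiffAt ℝ 2 (fun s => v s y) s := fun s hs =>
    (hreg.contDiffAt (x := (s, y)) (hopen.mem_nhds hs)).comp s
      (contDiffAt_id.prodMk contDiffAt_const)
  have hCy : ContDiff ℝ 2 (fun t => v x t) := contDiff_iff_contDiffAt.mpr fun t =>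
    (hreg.contDiffAt (x := (x, t)) (hopen.mem_nhds hx)).comp t
      (contDiffAt_const.prodMk contDiffAt_id)
  have hcompare : ∀ (s t : ℝ) (u : ℂ), 0 < s → ‖u‖ = 1 →
      ((starRingEnd ℂ) (v x y) * (u * v s t)).re - ‖v x y‖ * ε * halfPlaneBarrier β s t
        ≤ ((starRingEnd ℂ) (v x y) * v x y).re - ‖v x y‖ * ε * halfPlaneBarrier β x y := by
    intro s t u hs hu
    have h1 : ((starRingEnd ℂ) (v x y) * (u * v s t)).re ≤ ‖v x y‖ * ‖v s t‖ := by
      refine (Complex.re_le_norm _).trans_eq ?_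
      simp [hu]
    have h2 : ((starRingEnd ℂ) (v x y) * v x y).re = ‖v x y‖ * ‖v x y‖ := by
      rw [← Complex.normSq_eq_conj_mul_self, Complex.ofReal_re, Complex.normSq_eq_norm_sq, sq]
    have := mul_le_mul_of_nonneg_left (hmax s t hs) hn.le
    rw [h2]
    linarith
  have hreal : ∀ {f : ℝ → ℂ} {f' : ℂ} {t : ℝ}, HasDerivAt f f' t →
      HasDerivAt (fun s => ((starRingEnd ℂ) (v x y) * f s).re)
        ((starRingEnd ℂ) (v x y) * f').re t := fun h =>
    Complex.reCLM.hasFDerivAt.comp_hasDerivAt _ (h.const_mul _)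
  have hxx : ((starRingEnd ℂ) (v x y) * iteratedDeriv 2 (fun s => v s y) x).re
      - ‖v x y‖ * ε * (β * (β - 1) * x ^ (β - 2)
        + (1 - β) * (2 * (β / 2) * (x ^ 2 + y ^ 2) ^ (β / 2 - 1)
        + 4 * (β / 2) * (β / 2 - 1) * x ^ 2 * (x ^ 2 + y ^ 2) ^ (β / 2 - 2))) ≤ 0 := by
    refine second_deriv_nonpos_of_isLocalMax
      (f := fun s => ((starRingEnd ℂ) (v x y) * v s y).re
        - ‖v x y‖ * ε * (s ^ β + (1 - β) * (s ^ 2 + y ^ 2) ^ (β / 2)))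
      (f' := fun s => ((starRingEnd ℂ) (v x y) * deriv (fun s => v s y) s).re
        - ‖v x y‖ * ε * (β * s ^ (β - 1)
          + (1 - β) * (2 * (β / 2) * s * (s ^ 2 + y ^ 2) ^ (β / 2 - 1)))) (t := x) ?_ ?_ ?_
    · filter_upwards [lt_mem_nhds hx] with s hs
      exact (hreal ((hCx s hs).differentiableAt (by norm_num)).hasDerivAt).sub
        (((Real.hasDerivAt_rpow_const (Or.inl hs.ne')).add
          ((hasDerivAt_sq_add_rpow _ (by positivity)).const_mul _)).const_mul _)
    · have h1 : HasDerivAt (fun s : ℝ => β * s ^ (β - 1)) (β * (β - 1) * x ^ (β - 2)) x := by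
        refine ((Real.hasDerivAt_rpow_const (p := β - 1)
          (Or.inl hx.ne')).const_mul β).congr_deriv ?_
        rw [show β - 1 - 1 = β - 2 by ring]; ring
      have h2 : HasDerivAt (deriv fun s => v s y) (iteratedDeriv 2 (fun s => v s y) x) x := by
        rw [iteratedDeriv_succ, iteratedDeriv_one]
        exact (((hCx x hx).derivWithin (m := 1) (by norm_num)).differentiableAt (by norm_num)).hasDerivAt
      exact (hreal h2).sub ((h1.add
        ((hasDerivAt_deriv_sq_add_rpow _ (by positivity)).const_mul _)).const_mul _)
    · filter_upwards [lt_mem_nhds hx] with s hs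
      simpa [halfPlaneBarrier] using hcompare s y 1 hs (by simp)
  have hyy : ((starRingEnd ℂ) (v x y) * (iteratedDeriv 2 (fun t => v x t) y
        - 2 * Complex.I * k * deriv (fun t => v x t) y - k ^ 2 * v x y)).re
      - ‖v x y‖ * ε * ((1 - β) * (2 * (β / 2) * (y ^ 2 + x ^ 2) ^ (β / 2 - 1)
        + 4 * (β / 2) * (β / 2 - 1) * y ^ 2 * (y ^ 2 + x ^ 2) ^ (β / 2 - 2))) ≤ 0 := by
    set c : ℂ := -Complex.I * k with hc
    have hexp : ∀ t : ℝ, HasDerivAt (fun t : ℝ => Complex.exp (c * (t - y)))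
        (c * Complex.exp (c * (t - y))) t := by
      intro t
      have h1 : HasDerivAt (fun t : ℝ => c * ((t : ℂ) - y)) c t := by
        simpa using ((Complex.ofRealCLM.hasDerivAt (x := t)).sub_const (y : ℂ)).const_mul c
      simpa [mul_comm] using h1.cexp
    have hd1 : ∀ t, HasDerivAt (fun t => v x t) (deriv (fun t => v x t) t) t := fun t =>
      (hCy.differentiable (by norm_num) t).hasDerivAt
    have hd2 : HasDerivAt (deriv fun t => v x t) (iteratedDeriv 2 (fun t => v x t) y) y := by
      rw [iteratedDeriv_succ, iteratedDeriv_one]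
      exact ((hCy.differentiable_deriv_two) y).hasDerivAt
    refine second_deriv_nonpos_of_isLocalMax
      (f := fun t => ((starRingEnd ℂ) (v x y) * (Complex.exp (c * (t - y)) * v x t)).re
        - ‖v x y‖ * ε * (x ^ β + (1 - β) * (t ^ 2 + x ^ 2) ^ (β / 2)))
      (f' := fun t => ((starRingEnd ℂ) (v x y) * (c * Complex.exp (c * (t - y)) * v x t
          + Complex.exp (c * (t - y)) * deriv (fun t => v x t) t)).re
        - ‖v x y‖ * ε * ((1 - β) * (2 * (β / 2) * t * (t ^ 2 + x ^ 2) ^ (β / 2 - 1))))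
      (t := y) ?_ ?_ ?_
    · refine Eventually.of_forall fun t => ?_
      exact (hreal ((hexp t).mul (hd1 t))).sub
        ((((hasDerivAt_sq_add_rpow _ (by positivity)).const_mul _).const_add _).const_mul _)
    · refine ((hreal ((((hexp y).const_mul c).mul (hd1 y)).add ((hexp y).mul hd2))).sub
        (((hasDerivAt_deriv_sq_add_rpow _ (by positivity)).const_mul (1 - β)).const_mul
          (‖v x y‖ * ε))).congr_deriv ?_
      congr 3
      simp only [sub_self, mul_zero, Complex.exp_zero, mul_one, one_mul, hc]
      linear_combination (k : ℂ) ^ 2 * v x y * Complex.I_sq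
    · refine Eventually.of_forall fun t => ?_
      have hu : ‖Complex.exp (c * (t - y))‖ = 1 := by
        rw [show c * ((t : ℂ) - y) = ((-k * (t - y) : ℝ) : ℂ) * Complex.I by
          rw [hc]; push_cast; ring]
        exact Complex.norm_exp_ofReal_mul_I _
      simpa [halfPlaneBarrier, add_comm (x ^ 2)] using hcompare x t _ hx hu
  have hlap := mul_neg_of_pos_of_neg (mul_pos hn hε) (barrier_laplacian_neg y hβ0 hβ1 hx)
  have hsplit : ((starRingEnd ℂ) (v x y) * (iteratedDeriv 2 (fun s => v s y) x
      + iteratedDeriv 2 (fun t => v x t) y - 2 * Complex.I * k * deriv (fun t => v x t) y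
      - k ^ 2 * v x y)).re = ((starRingEnd ℂ) (v x y) * iteratedDeriv 2 (fun s => v s y) x).re
      + ((starRingEnd ℂ) (v x y) * (iteratedDeriv 2 (fun t => v x t) y
        - 2 * Complex.I * k * deriv (fun t => v x t) y - k ^ 2 * v x y)).re := by
    rw [← Complex.add_re]; congr 1; ring
  rw [hsplit]
  linarith

theorem two_le_modelE {s : ℝ} (hs : 0 < s) : 2 ≤ modelE s := by
  have ht : 0 < Real.tanh s ^ 2 := by
    have : 0 < Real.tanh s := by
      rw [Real.tanh_eq_sinh_div_cosh]
      exact div_pos (Real.sinh_pos_iff.mpr hs) (Real.cosh_pos s)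
    positivity
  have h := mul_inv_cancel₀ ht.ne'
  have hi := inv_pos.mpr ht
  unfold modelE
  nlinarith [sq_nonneg (Real.tanh s ^ 2 - (Real.tanh s ^ 2)⁻¹)]

/-- If `‖v‖ ≤ x ^ δ` exceeds a multiple of the barrier plus a constant somewhere, then the
difference attains a positive maximum. -/
theorem exists_max_sub_barrier {v : ℝ → ℝ → ℂ}
    (hcont : ContinuousOn (fun p : ℝ × ℝ => v p.1 p.2) {p : ℝ × ℝ | 0 < p.1})
    {β δ ε x₁ y₁ : ℝ} (hδ : 0 < δ) (hδβ : δ < β) (hβ1 : β < 1) (hε : 0 < ε)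
    (hbd : ∀ x y : ℝ, 0 < x → ‖v x y‖ ≤ x ^ δ) (hx₁ : 0 < x₁)
    (h₁ : ε * (halfPlaneBarrier β x₁ y₁ + 1) < ‖v x₁ y₁‖) :
    ∃ x y : ℝ, 0 < x ∧ v x y ≠ 0 ∧ ∀ s t : ℝ, 0 < s →
      ‖v s t‖ - ε * halfPlaneBarrier β s t ≤ ‖v x y‖ - ε * halfPlaneBarrier β x y := by
  have hβ0 : 0 < β := hδ.trans hδβ
  have hβ' : 0 < 1 - β := by linarith
  have hBnonneg : ∀ s t : ℝ, 0 < s → 0 ≤ halfPlaneBarrier β s t := fun s t hs => by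
    unfold halfPlaneBarrier; positivity
  obtain ⟨R, hR0, hR⟩ : ∃ R : ℝ, 0 < R ∧ ∀ m, R ≤ m → m ^ δ ≤ ε * ((1 - β) * m ^ β) := by
    have := (tendsto_rpow_atTop (sub_pos.mpr hδβ)).eventually_ge_atTop (1 / (ε * (1 - β)))
    obtain ⟨R, hR⟩ := eventually_atTop.mp this
    refine ⟨max R 1, by positivity, fun m hm => ?_⟩
    have hm0 : 0 < m := lt_of_lt_of_le (by positivity) hm
    have h1 := hR m ((le_max_left _ _).trans hm)
    rw [div_le_iff₀ (by positivity)] at h1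
    have h2 : m ^ β = m ^ (β - δ) * m ^ δ := by rw [← Real.rpow_add hm0]; ring_nf
    rw [h2]
    have := mul_le_mul_of_nonneg_right h1 (Real.rpow_nonneg hm0.le δ)
    linarith
  have hfar : ∀ s t m : ℝ, 0 < s → R ≤ m → s ≤ m → m ^ 2 ≤ s ^ 2 + t ^ 2 →
      ‖v s t‖ ≤ ε * halfPlaneBarrier β s t := by
    intro s t m hs hRm hsm hm
    have hm0 : 0 < m := hR0.trans_le hRm
    have h1 : m ^ β ≤ (s ^ 2 + t ^ 2) ^ (β / 2) := by
      calc m ^ β = (m ^ 2) ^ (β / 2) := by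
            rw [← Real.rpow_natCast, ← Real.rpow_mul hm0.le]; congr 1; push_cast; ring
        _ ≤ _ := Real.rpow_le_rpow (by positivity) hm (by positivity)
    calc ‖v s t‖ ≤ s ^ δ := hbd s t hs
      _ ≤ m ^ δ := Real.rpow_le_rpow hs.le hsm hδ.le
      _ ≤ ε * ((1 - β) * m ^ β) := hR m hRm
      _ ≤ ε * ((1 - β) * (s ^ 2 + t ^ 2) ^ (β / 2)) := by gcongr
      _ ≤ ε * halfPlaneBarrier β s t := by
          unfold halfPlaneBarrier
          have := Real.rpow_pos_of_pos hs β
          gcongr; linarith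
  set a : ℝ := ε ^ (1 / δ) with ha
  have ha0 : 0 < a := Real.rpow_pos_of_pos hε _
  have hnear : ∀ s t : ℝ, 0 < s → s ≤ a → ‖v s t‖ ≤ ε := by
    intro s t hs hsa
    calc ‖v s t‖ ≤ s ^ δ := hbd s t hs
      _ ≤ a ^ δ := Real.rpow_le_rpow hs.le hsa hδ.le
      _ = ε := by rw [ha, ← Real.rpow_mul hε.le, one_div_mul_cancel hδ.ne', Real.rpow_one]
  set K : Set (ℝ × ℝ) := Set.Icc a R ×ˢ Set.Icc (-R) R with hK
  have hout : ∀ s t : ℝ, 0 < s → (s, t) ∉ K → ‖v s t‖ - ε * halfPlaneBarrier β s t ≤ ε := by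
    intro s t hs hst
    have hB := mul_nonneg hε.le (hBnonneg s t hs)
    rcases le_total s a with h | h
    · linarith [hnear s t hs h]
    rcases le_total R s with h' | h'
    · linarith [hfar s t s hs h' le_rfl (by nlinarith)]
    have ht : R ≤ |t| := by
      by_contra! hlt
      exact hst ⟨⟨h, h'⟩, abs_le.mp hlt.le⟩
    linarith [hfar s t |t| hs ht (h'.trans ht) (by rw [sq_abs]; nlinarith)]
  have h₁K : (x₁, y₁) ∈ K := by
    by_contra h
    linarith [hout x₁ y₁ hx₁ h]
  have hKpos : ∀ p ∈ K, 0 < p.1 := fun p hp => ha0.trans_le hp.1.1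
  have hF : ContinuousOn (fun p : ℝ × ℝ => ‖v p.1 p.2‖ - ε * halfPlaneBarrier β p.1 p.2) K := by
    refine (hcont.mono hKpos).norm.sub (ContinuousOn.mul continuousOn_const ?_)
    unfold halfPlaneBarrier
    refine (continuousOn_fst.rpow_const fun p hp => Or.inl (hKpos p hp).ne').add
      (continuousOn_const.mul (Continuous.continuousOn ?_))
    exact (by fun_prop : Continuous fun p : ℝ × ℝ => p.1 ^ 2 + p.2 ^ 2).rpow_const
      fun _ => Or.inr (by positivity)
  obtain ⟨⟨x, y⟩, hxyK, hmax⟩ := (isCompact_Icc.prod isCompact_Icc).exists_isMaxOn ⟨_, h₁K⟩ hF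
  have hx : 0 < x := hKpos _ hxyK
  have h₁max : ε < ‖v x y‖ - ε * halfPlaneBarrier β x y := by
    have := hmax h₁K
    simp only [Set.mem_ofPred_eq] at this
    linarith
  refine ⟨x, y, hx, ?_, fun s t hs => ?_⟩
  · rw [← norm_pos_iff]
    linarith [mul_nonneg hε.le (hBnonneg x y hx)]
  · by_cases hst : (s, t) ∈ K
    · exact hmax hst
    · exact (hout s t hs hst).trans h₁max.le

/-- Vanishing of solutions of the off-diagonal model equation
`Δ v + 2 i p(λx) x ∂_y v + p(λx)² v − 2 λ² x² conj(v) + λ² x² E(λx) v = 0`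
on the hyperbolic half-plane which satisfy `|v| ≤ x^δ` with `0 < δ < 1`. -/
theorem trivial_kernel_model_space_off_diag
    (lam δ : ℝ) (hlam : 0 < lam) (hδl : 0 < δ) (hδu : δ < 1)
    (v : ℝ → ℝ → ℂ)
    (hreg : ContDiffOn ℝ 2 (fun p : ℝ × ℝ => v p.1 p.2) {p : ℝ × ℝ | 0 < p.1})
    (hpde : ∀ x y : ℝ, 0 < x →
      -(x : ℂ) ^ 2 * (iteratedDeriv 2 (fun s => v s y) x + iteratedDeriv 2 (fun s => v x s) y)
        + 2 * Complex.I * (modelP (lam * x) : ℂ) * (x : ℂ) * deriv (fun s => v x s) y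
        + (modelP (lam * x) : ℂ) ^ 2 * v x y
        - 2 * (lam : ℂ) ^ 2 * (x : ℂ) ^ 2 * (starRingEnd ℂ) (v x y)
        + (lam : ℂ) ^ 2 * (x : ℂ) ^ 2 * (modelE (lam * x) : ℂ) * v x y = 0)
    (hbd : ∀ x y : ℝ, 0 < x → ‖v x y‖ ≤ x ^ δ) :
    ∀ x y : ℝ, 0 < x → v x y = 0 := by
  set β : ℝ := (1 + δ) / 2 with hβ
  have hδβ : δ < β := by rw [hβ]; linarith
  have hβ1 : β < 1 := by rw [hβ]; linarith
  have hle : ∀ ε : ℝ, 0 < ε → ∀ x y : ℝ, 0 < x →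
      ‖v x y‖ ≤ ε * (halfPlaneBarrier β x y + 1) := by
    intro ε hε x₁ y₁ hx₁
    by_contra! hlt
    obtain ⟨x, y, hx, hv, hmax⟩ :=
      exists_max_sub_barrier hreg.continuousOn hδl hδβ hβ1 hε hbd hx₁ hlt
    have hneg := re_twisted_laplacian_neg_of_max hreg (hδl.trans hδβ) hβ1 hε hx hv hmax
      (modelP (lam * x) / x)
    have hxc : (x : ℂ) ≠ 0 := Complex.ofReal_ne_zero.mpr hx.ne'
    have hlaplacian : iteratedDeriv 2 (fun s => v s y) x + iteratedDeriv 2 (fun t => v x t) y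
        - 2 * Complex.I * ((modelP (lam * x) / x : ℝ) : ℂ) * deriv (fun t => v x t) y
        - ((modelP (lam * x) / x : ℝ) : ℂ) ^ 2 * v x y
        = ((lam ^ 2 : ℝ) : ℂ) * (((modelE (lam * x) : ℝ) : ℂ) * v x y
          - 2 * (starRingEnd ℂ) (v x y)) := by
      push_cast
      field_simp
      linear_combination -hpde x y hx
    rw [hlaplacian] at hneg
    have hE := two_le_modelE (mul_pos hlam hx)
    have hre : ((starRingEnd ℂ) (v x y) * (((lam ^ 2 : ℝ) : ℂ) *
        (((modelE (lam * x) : ℝ) : ℂ) * v x y - 2 * (starRingEnd ℂ) (v x y)))).re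
        = lam ^ 2 * ((modelE (lam * x) - 2) * ((v x y).re ^ 2 + (v x y).im ^ 2)
          + 4 * (v x y).im ^ 2) := by
      simp only [Complex.mul_re, Complex.mul_im, Complex.sub_re, Complex.sub_im, Complex.conj_re,
        Complex.conj_im, Complex.ofReal_re, Complex.ofReal_im, Complex.re_ofNat, Complex.im_ofNat]
      ring
    rw [hre] at hneg
    have : 0 ≤ modelE (lam * x) - 2 := by linarith
    exact absurd hneg (not_lt.mpr (by positivity))
  intro x y hx
  have hlim : Tendsto (fun ε : ℝ => ε * (halfPlaneBarrier β x y + 1)) (𝓝[>] 0) (𝓝 0) := by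
    have : Tendsto (fun ε : ℝ => ε * (halfPlaneBarrier β x y + 1)) (𝓝 0) (𝓝 0) := by
      simpa using (continuous_id.mul_const (halfPlaneBarrier β x y + 1)).tendsto (0 : ℝ)
    exact this.mono_left nhdsWithin_le_nhds
  refine norm_le_zero_iff.mp (ge_of_tendsto hlim ?_)
  filter_upwards [self_mem_nhdsWithin] with ε hε using hle ε hε x y hx
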